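/- Let ν be a norm on ℝ^N, let w ∈ ℝ₊₊^N, and let Φ : ℝ^N → ℝ be defined by Φ(s) = ∑ₙ wₙ·φ(sₙ) with φ(s) = −log(1+s) for s ≥ 0 and φ(s) = −s for s < 0. Then: (a) for every b > 0 there is a unique minimizer of Φ over [0,b]^N ∩ {s ∈ ℝ^N | ν(s) ≤ 1}; and (b) there exists c > 0 such that for every b ≥ c, this unique minimizer coincides with the unique minimizer of Φ over 𝒮 := {s ∈ ℝ₊^N | ν(s) ≤ 1}. -/

import Mathlib

/-- `φ(s) = −log(1+s)` for `s ≥ 0` and `φ(s) = −s` for `s < 0`. -/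
noncomputable def phiFun (s : ℝ) : ℝ :=
  if 0 ≤ s then -Real.log (1 + s) else -s

/-- `Φ(s) = ∑ₙ wₙ φ(sₙ)`. -/
noncomputable def PhiFun (N : ℕ) (w : EuclideanSpace ℝ (Fin N))
    (s : EuclideanSpace ℝ (Fin N)) : ℝ :=
  ∑ n, w n * phiFun (s n)

/-- On the nonnegative half-line, `phiFun` is `s ↦ -log (1 + s)`, hence strictly convex. -/
theorem strictConvexOn_phiFun : StrictConvexOn ℝ (Set.Ici 0) phiFun := by
  refine ⟨convex_Ici 0, fun x hx y hy hxy a b ha hb hab => ?_⟩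
  have hx : 0 ≤ x := hx
  have hy : 0 ≤ y := hy
  have hz : 0 ≤ a • x + b • y := by
    simp only [smul_eq_mul]
    positivity
  have h := strictConcaveOn_log_Ioi.2 (x := 1 + x) (y := 1 + y)
    (Set.mem_Ioi.2 (by linarith)) (Set.mem_Ioi.2 (by linarith))
    (fun h => hxy (add_left_cancel h)) ha hb hab
  have e : a • (1 + x) + b • (1 + y) = 1 + (a • x + b • y) := by
    simp only [smul_eq_mul]
    linear_combination hab
  rw [e] at h
  simp only [phiFun, if_pos hx, if_pos hy, if_pos hz]
  simp only [smul_eq_mul] at h ⊢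
  linarith

theorem continuousOn_phiFun : ContinuousOn phiFun (Set.Ici 0) := by
  have h : ContinuousOn (fun s : ℝ => -Real.log (1 + s)) (Set.Ici 0) := by
    refine ContinuousOn.neg (ContinuousOn.log (by fun_prop) fun s hs => ?_)
    have hs : 0 ≤ s := hs
    positivity
  exact h.congr fun s hs => if_pos hs

theorem convex_nonneg_orthant (N : ℕ) :
    Convex ℝ {s : EuclideanSpace ℝ (Fin N) | ∀ n, 0 ≤ s n} := by
  intro x hx y hy a b ha hb _ n
  have h1 := mul_nonneg ha (hx n)
  have h2 := mul_nonneg hb (hy n)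
  simpa using add_nonneg h1 h2

theorem strictConvexOn_PhiFun (N : ℕ) {w : EuclideanSpace ℝ (Fin N)} (hw : ∀ n, 0 < w n) :
    StrictConvexOn ℝ {s : EuclideanSpace ℝ (Fin N) | ∀ n, 0 ≤ s n} (PhiFun N w) := by
  refine ⟨convex_nonneg_orthant N, fun x hx y hy hxy a b ha hb hab => ?_⟩
  obtain ⟨i, hi⟩ : ∃ i, x i ≠ y i := by
    by_contra! h
    exact hxy (PiLp.ext h)
  simp only [PhiFun, smul_eq_mul, Finset.mul_sum, ← Finset.sum_add_distrib]
  refine Finset.sum_lt_sum (fun n _ => ?_) ⟨i, Finset.mem_univ i, ?_⟩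
  · have h := strictConvexOn_phiFun.convexOn.2 (hx n) (hy n) ha.le hb.le hab
    have h' := mul_le_mul_of_nonneg_left h (hw n).le
    simp only [smul_eq_mul] at h'
    simp only [PiLp.add_apply, PiLp.smul_apply, smul_eq_mul]
    linarith
  · have h := strictConvexOn_phiFun.2 (hx i) (hy i) hi ha hb hab
    have h' := mul_lt_mul_of_pos_left h (hw i)
    simp only [smul_eq_mul] at h'
    simp only [PiLp.add_apply, PiLp.smul_apply, smul_eq_mul]
    linarith

theorem continuousOn_PhiFun (N : ℕ) (w : EuclideanSpace ℝ (Fin N)) :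
    ContinuousOn (PhiFun N w) {s : EuclideanSpace ℝ (Fin N) | ∀ n, 0 ≤ s n} := by
  refine continuousOn_finsetSum _ fun n _ => continuousOn_const.mul ?_
  exact continuousOn_phiFun.comp (by fun_prop) fun s hs => hs n

theorem Seminorm.continuous_of_finiteDimensional {E : Type*} [NormedAddCommGroup E]
    [NormedSpace ℝ E] [FiniteDimensional ℝ E] (p : Seminorm ℝ E) : Continuous p :=
  continuousOn_univ.1 (p.convexOn.continuousOn isOpen_univ)

/-- A positive definite seminorm on a finite-dimensional space dominates the norm. -/
theorem Seminorm.exists_norm_le_mul_of_finiteDimensional {E : Type*} [NormedAddCommGroup E]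
    [NormedSpace ℝ E] [FiniteDimensional ℝ E] (p : Seminorm ℝ E) (hp : ∀ x, p x = 0 → x = 0) :
    ∃ C : ℝ, 0 < C ∧ ∀ x, ‖x‖ ≤ C * p x := by
  rcases subsingleton_or_nontrivial E with h | h
  · exact ⟨1, one_pos, fun x => by simp [Subsingleton.elim x 0]⟩
  obtain ⟨u, hu, hmin⟩ := (isCompact_sphere (0 : E) 1).exists_isMinOn
    (NormedSpace.sphere_nonempty.2 zero_le_one) p.continuous_of_finiteDimensional.continuousOn
  have hu1 : ‖u‖ = 1 := by simpa using hu
  have hpu : 0 < p u := (apply_nonneg p u).lt_of_ne' fun h0 => by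
    simp [hp u h0] at hu1
  refine ⟨(p u)⁻¹, inv_pos.2 hpu, fun x => ?_⟩
  rcases eq_or_ne x 0 with rfl | hx
  · simp
  have hx' : 0 < ‖x‖ := norm_pos_iff.2 hx
  have hmem : ‖x‖⁻¹ • x ∈ Metric.sphere (0 : E) 1 := by
    simp [norm_smul, hx'.ne']
  have hle : p u ≤ p (‖x‖⁻¹ • x) := hmin hmem
  rw [map_smul_eq_mul, norm_inv, norm_norm, inv_mul_eq_div, le_div_iff₀ hx'] at hle
  rwa [inv_mul_eq_div, le_div_iff₀ hpu, mul_comm]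

/-- for a norm `ν` on `ℝ^N`, (a) for every `b > 0` the function `Φ` has a
unique minimizer over `[0,b]^N ∩ {ν ≤ 1}`; and (b) for all large enough `b`, this
minimizer coincides with the unique minimizer of `Φ` over `𝒮 = {s ∈ ℝ₊^N | ν(s) ≤ 1}`. -/
theorem stmt_13 (N : ℕ) (hN : 1 ≤ N)
    (ν : EuclideanSpace ℝ (Fin N) → ℝ)
    (hν_add : ∀ x y : EuclideanSpace ℝ (Fin N), ν (x + y) ≤ ν x + ν y)
    (hν_smul : ∀ (c : ℝ) (x : EuclideanSpace ℝ (Fin N)), ν (c • x) = |c| * ν x)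
    (hν_zero : ∀ x : EuclideanSpace ℝ (Fin N), ν x = 0 ↔ x = 0)
    (w : EuclideanSpace ℝ (Fin N)) (hw : ∀ n, 0 < w n) :
    (∀ b : ℝ, 0 < b →
      ∃! s : EuclideanSpace ℝ (Fin N),
        ((∀ n, 0 ≤ s n ∧ s n ≤ b) ∧ ν s ≤ 1) ∧
        ∀ y : EuclideanSpace ℝ (Fin N), ((∀ n, 0 ≤ y n ∧ y n ≤ b) ∧ ν y ≤ 1) →
          PhiFun N w s ≤ PhiFun N w y) ∧
    (∃ c : ℝ, 0 < c ∧ ∀ b : ℝ, c ≤ b →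
      ∀ s : EuclideanSpace ℝ (Fin N),
        (((∀ n, 0 ≤ s n ∧ s n ≤ b) ∧ ν s ≤ 1) ∧
          ∀ y : EuclideanSpace ℝ (Fin N), ((∀ n, 0 ≤ y n ∧ y n ≤ b) ∧ ν y ≤ 1) →
            PhiFun N w s ≤ PhiFun N w y) ↔
        (((∀ n, 0 ≤ s n) ∧ ν s ≤ 1) ∧
          ∀ y : EuclideanSpace ℝ (Fin N), ((∀ n, 0 ≤ y n) ∧ ν y ≤ 1) →
            PhiFun N w s ≤ PhiFun N w y)) := by
  let p : Seminorm ℝ (EuclideanSpace ℝ (Fin N)) := Seminorm.of ν hν_add hν_smul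
  have hν_cont : Continuous ν := p.continuous_of_finiteDimensional
  obtain ⟨C, hC, hbound⟩ :=
    p.exists_norm_le_mul_of_finiteDimensional fun x hx => (hν_zero x).1 hx
  have hcoord : ∀ s, ν s ≤ 1 → ∀ n, s n ≤ C := fun s hs n =>
    calc s n ≤ ‖s n‖ := le_abs_self _
      _ ≤ ‖s‖ := PiLp.norm_apply_le s n
      _ ≤ C * ν s := hbound s
      _ ≤ C := mul_le_of_le_one_right hC.le hs
  refine ⟨fun b hb => ?_, C, hC, fun b hb s => ?_⟩
  · let K : Set (EuclideanSpace ℝ (Fin N)) := {s | (∀ n, 0 ≤ s n ∧ s n ≤ b) ∧ ν s ≤ 1}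
    have hK_sub : K ⊆ {s | ∀ n, 0 ≤ s n} := fun s hs n => (hs.1 n).1
    have hK_conv : Convex ℝ K := by
      have h : K = {s | ∀ n, s n ∈ Set.Icc 0 b} ∩ {s | s ∈ Set.univ ∧ p s ≤ 1} := by
        ext s
        simp only [K, Set.mem_inter_iff, Set.mem_ofPred_eq, Set.mem_Icc, Set.mem_univ, true_and]
        rfl
      rw [h]
      refine Convex.inter (fun x hx y hy α β hα hβ hαβ n => ?_) (p.convexOn.convex_le 1)
      simpa using convex_Icc 0 b (hx n) (hy n) hα hβ hαβ
    have hK_closed : IsClosed K := by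
      have h : K = (⋂ n, (fun s => s n) ⁻¹' Set.Icc 0 b) ∩ {s | ν s ≤ 1} := by
        ext s
        simp [K]
      rw [h]
      exact (isClosed_iInter fun n => isClosed_Icc.preimage (by fun_prop)).inter
        (isClosed_le hν_cont continuous_const)
    have hK_compact : IsCompact K := by
      refine (isCompact_closedBall 0 C).of_isClosed_subset hK_closed fun s hs => ?_
      rw [mem_closedBall_zero_iff]
      exact (hbound s).trans (mul_le_of_le_one_right hC.le hs.2)
    have hK_ne : K.Nonempty := ⟨0, by simp [K, hb.le, (hν_zero 0).2 rfl]⟩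
    obtain ⟨s, hs, hmin⟩ :=
      hK_compact.exists_isMinOn hK_ne ((continuousOn_PhiFun N w).mono hK_sub)
    refine ⟨s, ⟨hs, fun y hy => hmin hy⟩, fun t ht => ?_⟩
    exact ((strictConvexOn_PhiFun N hw).subset hK_sub hK_conv).eq_of_isMinOn
      (fun y hy => ht.2 y hy) hmin ht.1 hs
  · have hiff : ∀ y : EuclideanSpace ℝ (Fin N),
        ((∀ n, 0 ≤ y n ∧ y n ≤ b) ∧ ν y ≤ 1) ↔ ((∀ n, 0 ≤ y n) ∧ ν y ≤ 1) := fun y =>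
      ⟨fun h => ⟨fun n => (h.1 n).1, h.2⟩,
        fun h => ⟨fun n => ⟨h.1 n, (hcoord y h.2 n).trans hb⟩, h.2⟩⟩
    simp only [hiff]
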